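/- There is no sequence b = (b_1, b_2, b_3, …) of positive integers satisfying both of the following: [T^k b] ≤ [b] for every k ≥ 0, and √3 < [1, 1, b_1, b_2, …] < (7 + √13)/6. (Equivalently: no element of the Sturmian spectrum lies strictly between √3 and (7 + √13)/6.) -/

import Mathlib

open Filter

/-- `cfFin k b` is the value of the finite continued fraction `[b 0; b 1, ..., b k]`
(so `b` lists the partial quotients, `b 0` first). -/
noncomputable def cfFin : ℕ → (ℕ → ℕ) → ℝ
  | 0, b => b 0
  | (k + 1), b => b 0 + 1 / cfFin k (fun i => b (i + 1))

lemma cfFin_one_le (m : ℕ) : ∀ b : ℕ → ℕ, (∀ k, 0 < b k) → 1 ≤ cfFin m b := by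
  induction m with
  | zero =>
    intro b hb
    have := hb 0
    simp only [cfFin]
    exact_mod_cast this
  | succ m ih =>
    intro b hb
    have h0 : (1 : ℝ) ≤ b 0 := by exact_mod_cast hb 0
    have h1 := ih (fun i => b (i + 1)) (fun k => hb (k + 1))
    have h2 : 0 < 1 / cfFin m (fun i => b (i + 1)) := by positivity
    simp only [cfFin]
    linarith

lemma cf_rec (b : ℕ → ℕ) (y z : ℝ) (hz : 1 ≤ z)
    (h1 : Tendsto (fun m => cfFin m b) atTop (nhds y))
    (h2 : Tendsto (fun m => cfFin m (fun i => b (i + 1))) atTop (nhds z)) :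
    y = b 0 + 1 / z := by
  have h3 := (tendsto_add_atTop_iff_nat 1).2 h1
  have h4 : Tendsto (fun m => (b 0 : ℝ) + 1 / cfFin m (fun i => b (i + 1))) atTop
      (nhds (b 0 + 1 / z)) :=
    tendsto_const_nhds.add (tendsto_const_nhds.div h2 (by positivity))
  exact tendsto_nhds_unique h3 h4

/-- There is no sequence of positive integers `b` such that `[T^k b] ≤ [b]` for all
`k ≥ 0` and `√3 < [1, 1, b_1, b_2, ...] < (7 + √13)/6`. Here `v k` denotes the value of
the infinite continued fraction `[T^k b] = [b_{k+1}; b_{k+2}, ...]` (the limit of its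
finite truncations) and `x` the value of `[1; 1, b_1, b_2, ...]`. -/
theorem stmt18 :
    ¬ ∃ (b : ℕ → ℕ) (v : ℕ → ℝ) (x : ℝ),
      (∀ k, 0 < b k) ∧
      (∀ k, Tendsto (fun m => cfFin m (fun i => b (i + k))) atTop (nhds (v k))) ∧
      Tendsto (fun m => cfFin m
        (fun i => if i = 0 then 1 else if i = 1 then 1 else b (i - 2))) atTop (nhds x) ∧
      (∀ k, v k ≤ v 0) ∧
      Real.sqrt 3 < x ∧ x < (7 + Real.sqrt 13) / 6 := by
  rintro ⟨b, v, x, hb, hv, hx, hmax, hl, hu⟩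
  have v1 : ∀ k, 1 ≤ v k := fun k =>
    ge_of_tendsto' (hv k) (fun m => cfFin_one_le m _ (fun i => hb (i + k)))
  have hrec : ∀ k, v k = b k + 1 / v (k + 1) := by
    intro k
    have h2 := hv (k + 1)
    have := cf_rec (fun i => b (i + k)) (v k) (v (k + 1)) (v1 _) (hv k)
      (by convert h2 using 5; omega)
    simpa using this
  have hM := v1 0
  set c : ℕ → ℕ := fun i => if i = 0 then 1 else if i = 1 then 1 else b (i - 2) with hc
  have t2 : Tendsto (fun m => cfFin m (fun i => c (i + 1 + 1))) atTop (nhds (v 0)) := by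
    have := hv 0
    simpa [hc] using this
  have t1 : Tendsto (fun m => cfFin m (fun i => c (i + 1))) atTop (nhds (1 + 1 / v 0)) := by
    rw [← tendsto_add_atTop_iff_nat 1]
    have h4 : Tendsto (fun m => (1 : ℝ) + 1 / cfFin m (fun i => c (i + 1 + 1))) atTop
        (nhds (1 + 1 / v 0)) :=
      tendsto_const_nhds.add (tendsto_const_nhds.div t2 (by positivity))
    refine h4.congr fun m => ?_
    simp [cfFin, hc]
  have hpos : 0 < 1 / v 0 := by positivity
  have hx' := cf_rec c x _ (by linarith) hx t1
  have hc0 : (c 0 : ℝ) = 1 := by simp [hc]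
  rw [hc0] at hx'
  have r0 := hrec 0
  have r1 := hrec 1
  have m1 := hmax 1
  have m2 := hmax 2
  have p1 := v1 1
  have p2 := v1 2
  norm_num only [zero_add] at r0 r1
  generalize v 0 = M at *
  have hxe : x * (M + 1) = 2 * M + 1 := by
    rw [hx']; field_simp; ring
  have s3 : Real.sqrt 3 ^ 2 = 3 := Real.sq_sqrt (by norm_num)
  have s13 : Real.sqrt 13 ^ 2 = 13 := Real.sq_sqrt (by norm_num)
  have n3 := Real.sqrt_nonneg 3
  have n13 := Real.sqrt_nonneg 13
  have s3lt : Real.sqrt 3 < 2 := by nlinarith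
  have s13lt : Real.sqrt 13 < 4 := by nlinarith
  have lo : 1 + Real.sqrt 3 < M := by
    have : Real.sqrt 3 * (M + 1) < 2 * M + 1 := by rw [← hxe]; gcongr
    have h5 : 0 < (2 - Real.sqrt 3) * (M - 1 - Real.sqrt 3) := by nlinarith
    have := (mul_pos_iff_of_pos_left (by linarith : 0 < 2 - Real.sqrt 3)).1 h5
    linarith
  have hi : M < (3 + Real.sqrt 13) / 2 := by
    have : 2 * M + 1 < (7 + Real.sqrt 13) / 6 * (M + 1) := by rw [← hxe]; gcongr
    have h5 : 0 < (5 - Real.sqrt 13) * ((3 + Real.sqrt 13) / 2 - M) := by nlinarith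
    have := (mul_pos_iff_of_pos_left (by linarith : 0 < 5 - Real.sqrt 13)).1 h5
    linarith
  rcases Nat.lt_or_ge (b 0) 3 with h | h
  · have hb0 : (b 0 : ℝ) ≤ 2 := by exact_mod_cast Nat.le_of_lt_succ h
    have hb1 : (1 : ℝ) ≤ b 1 := by exact_mod_cast hb 1
    have e2 : 1 / M ≤ 1 / v 2 := by gcongr
    have e1 : 1 / v 1 ≤ 1 / (1 + 1 / M) := by gcongr; linarith
    have e3 : M ≤ 2 + 1 / (1 + 1 / M) := by linarith
    have e4 : 1 / (1 + 1 / M) = M / (M + 1) := by field_simp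
    have e5 : M / (M + 1) * (M + 1) = M := by field_simp
    rw [e4] at e3
    have e6 : M * (M + 1) ≤ (2 + M / (M + 1)) * (M + 1) := by gcongr
    have e7 : Real.sqrt 3 ^ 2 < (M - 1) ^ 2 := by
      apply pow_lt_pow_left₀ _ n3 (by norm_num)
      linarith
    rw [add_mul, e5] at e6
    linarith only [e6, e7, s3]
  · have hb0 : (3 : ℝ) ≤ b 0 := by exact_mod_cast h
    have e2 : 1 / M ≤ 1 / v 1 := by gcongr
    have e5 : 1 / M * M = 1 := by field_simp
    have e6 : 3 + 1 / M ≤ M := by linarith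
    have e7 : (3 + 1 / M) * M ≤ M * M := by gcongr
    have hM3 : 3 ≤ M := by linarith
    have e8 : (2 * M - 3) ^ 2 < Real.sqrt 13 ^ 2 := by
      apply pow_lt_pow_left₀ _ (by linarith) (by norm_num)
      linarith
    rw [add_mul, e5] at e7
    linarith only [e7, e8, s13]
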